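/- Let k be a field, q transcendental over k, and consider the rank-one q-difference equation y(qx) = P(q) y(x) with P ∈ k(q)*. If P(ζ)^{ord(ζ)} = 1 for almost all roots of unity ζ at which P is defined, then P(q) = λ q^s for some root of unity λ and rational number s = a/r with P(q)^r = q^a. -/

import Mathlib

open Polynomial

theorem Polynomial.le_natDegree_of_X_sub_C_pow_dvd_expand {F : Type*} [Field F] {m e : ℕ}
    (hm : (m : F) ≠ 0) {G : F[X]} (hG : G ≠ 0) {α : F} (hα : α ≠ 0)
    (h : (X - C α) ^ e ∣ expand F m G) : e ≤ G.natDegree := by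
  have hm0 : 0 < m := Nat.pos_of_ne_zero fun h0 => hm (by simp [h0])
  obtain ⟨H, hGH, hH⟩ := exists_eq_pow_rootMultiplicity_mul_and_not_dvd G hG (α ^ m)
  set s := rootMultiplicity (α ^ m) G
  have hsep : (X ^ m - C (α ^ m) : F[X]).Separable :=
    separable_X_pow_sub_C _ hm (pow_ne_zero _ hα)
  have hexp : expand F m G = (X ^ m - C (α ^ m)) ^ s * expand F m H := by
    conv_lhs => rw [hGH]
    simp
  have hG' : expand F m G ≠ 0 := (expand_eq_zero hm0).not.mpr hG
  have hHroot : rootMultiplicity α (expand F m H) = 0 := by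
    apply rootMultiplicity_eq_zero
    rw [IsRoot, expand_eval]
    rwa [dvd_iff_isRoot] at hH
  have hpow : ∀ s : ℕ, rootMultiplicity α ((X ^ m - C (α ^ m) : F[X]) ^ s) ≤ s := by
    intro s
    induction s with
    | zero => simp
    | succ s ih =>
      rw [pow_succ, rootMultiplicity_mul (mul_ne_zero (pow_ne_zero _ hsep.ne_zero) hsep.ne_zero)]
      exact Nat.add_le_add ih (rootMultiplicity_le_one_of_separable hsep α)
  calc e ≤ rootMultiplicity α (expand F m G) := (le_rootMultiplicity_iff hG').mpr h
    _ ≤ s := by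
      rw [hexp, rootMultiplicity_mul (hexp ▸ hG'), hHroot]
      exact hpow s
    _ ≤ G.natDegree := by
      classical
      rw [show s = _ from (count_roots G).symm]
      exact (Multiset.count_le_card _ _).trans (card_roots' G)

theorem Polynomial.exists_eq_C_mul_X_pow {F : Type*} [Field F] [IsAlgClosed F] {A : F[X]}
    (h : ∀ α, A.IsRoot α → α = 0) : ∃ (c : F) (a : ℕ), A = C c * X ^ a := by
  refine ⟨A.leadingCoeff, A.roots.card, ?_⟩
  conv_lhs => rw [(IsAlgClosed.splits A).eq_prod_roots]
  have : A.roots = Multiset.replicate A.roots.card 0 :=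
    Multiset.eq_replicate_card.mpr fun b hb => h b (isRoot_of_mem_roots hb)
  rw [this]
  simp

theorem Polynomial.exists_coeff_eq_linearMap {F K : Type*} [Field F] [Field K] [Algebra F K]
    (φ : K →ₗ[F] F) (A : K[X]) :
    ∃ A' : F[X], (∀ i, A'.coeff i = φ (A.coeff i)) ∧
      ∀ x, A'.eval x = φ (A.eval (algebraMap F K x)) := by
  refine ⟨∑ i ∈ Finset.range (A.natDegree + 1), monomial i (φ (A.coeff i)), fun i => ?_,
    fun x => ?_⟩
  · simp only [finsetSum_coeff, coeff_monomial, Finset.sum_ite_eq', Finset.mem_range]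
    split_ifs with h
    · rfl
    · rw [coeff_eq_zero_of_natDegree_lt (by omega), map_zero]
  · rw [eval_eq_sum_range (p := A), eval_finsetSum, map_sum]
    refine Finset.sum_congr rfl fun i _ => ?_
    rw [eval_monomial, ← map_pow, mul_comm (A.coeff i), ← Algebra.smul_def, map_smul, smul_eq_mul,
      mul_comm]

theorem Polynomial.exists_mul_map_eq_mul_map_of_infinite {F K : Type*} [Field F] [Field K]
    [Algebra F K] {A B : K[X]} (hB : B ≠ 0)
    (h : {x : F | ∃ c : F, A.eval (algebraMap F K x) =
      algebraMap F K c * B.eval (algebraMap F K x)}.Infinite) :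
    ∃ A' B' : F[X], B' ≠ 0 ∧ A * B'.map (algebraMap F K) = B * A'.map (algebraMap F K) := by
  obtain ⟨i, hi⟩ : ∃ i, B.coeff i ≠ 0 := by
    by_contra! hB'
    exact hB (ext hB')
  obtain ⟨φ, hφ⟩ : ∃ φ : Module.Dual F K, φ (B.coeff i) ≠ 0 := by
    by_contra! hφ
    exact hi ((Module.forall_dual_apply_eq_zero_iff F _).mp hφ)
  obtain ⟨A', -, hA'⟩ := exists_coeff_eq_linearMap φ A
  obtain ⟨B', hBc, hB'⟩ := exists_coeff_eq_linearMap φ B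
  refine ⟨A', B', fun h0 => hφ (by rw [← hBc, h0, coeff_zero]), ?_⟩
  refine eq_of_infinite_eval_eq _ _ ((h.image (algebraMap F K).injective.injOn).mono ?_)
  rintro _ ⟨x, ⟨c, hc⟩, rfl⟩
  have : A'.eval x = c * B'.eval x := by
    rw [hA', hB', hc, ← Algebra.smul_def, map_smul, smul_eq_mul]
  simp only [Set.mem_ofPred_eq, eval_mul, eval_map_apply, hc, this, map_mul]
  ring

theorem infinite_setOf_isPrimitiveRoot {F : Type*} [Field F] [IsAlgClosed F] {d : ℕ} (hd : 0 < d)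
    (h : ∀ t : ℕ, ((d * t + 1 : ℕ) : F) ≠ 0) :
    {ζ : F | ∃ t, IsPrimitiveRoot ζ (d * t + 1)}.Infinite := by
  have hex : ∀ t : ℕ, ∃ ζ : F, IsPrimitiveRoot ζ (d * t + 1) := fun t =>
    have : NeZero ((d * t + 1 : ℕ) : F) := ⟨h t⟩
    HasEnoughRootsOfUnity.exists_primitiveRoot F _
  choose ζ hζ using hex
  refine Set.infinite_of_injective_forall_mem (f := ζ) (fun s t hst => ?_) fun t => ⟨t, hζ t⟩
  have := (hζ s).unique (hst ▸ hζ t)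
  exact Nat.eq_of_mul_eq_mul_left hd (by omega)

theorem exists_forall_natCast_mul_add_one_ne_zero (F : Type*) [Field F] :
    ∃ d : ℕ, 0 < d ∧ ∀ t : ℕ, ((d * t + 1 : ℕ) : F) ≠ 0 := by
  obtain ⟨p, hp⟩ := CharP.exists F
  rcases CharP.char_is_prime_or_zero F p with hprime | rfl
  · exact ⟨p, hprime.pos, fun t => by simp⟩
  · have := CharP.charP_to_charZero F
    exact ⟨1, one_pos, fun t => Nat.cast_ne_zero.mpr (by omega)⟩

/-- `A(ζ) ^ n = B(ζ) ^ n` for every root of unity `ζ ∉ S`, where `n` is the order of `ζ`. -/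
def UnitaryOutside {F : Type*} [Field F] (S : Finset F) (A B : F[X]) : Prop :=
  ∀ (ζ : F) (n : ℕ), 0 < n → IsPrimitiveRoot ζ n → ζ ∉ S → A.eval ζ ^ n = B.eval ζ ^ n

theorem UnitaryOutside.exists_pow_mul_eq {F : Type*} [Field F] [IsAlgClosed F] {S : Finset F}
    {A B : F[X]} (h : UnitaryOutside S A B)
    (hroot : ∀ α, α ≠ 0 → ¬ A.IsRoot α ∧ ¬ B.IsRoot α) :
    ∃ a b r : ℕ, 1 ≤ r ∧ A ^ r * X ^ a = B ^ r * X ^ b := by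
  obtain ⟨c, a, hA⟩ := exists_eq_C_mul_X_pow fun α h => by_contra fun hα => (hroot α hα).1 h
  obtain ⟨d, b, hB⟩ := exists_eq_C_mul_X_pow fun α h => by_contra fun hα => (hroot α hα).2 h
  obtain ⟨e, he, hne⟩ := exists_forall_natCast_mul_add_one_ne_zero F
  obtain ⟨ζ, ⟨t, ht⟩, hζS⟩ := (infinite_setOf_isPrimitiveRoot he hne).exists_notMem_finset S
  obtain ⟨n, hn⟩ : ∃ n, n = e * t + 1 := ⟨_, rfl⟩
  rw [← hn] at ht
  have hval := h ζ n (by omega) ht hζS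
  have hcd : c ^ n = d ^ n := by
    have hζ : ∀ i : ℕ, (ζ ^ i) ^ n = 1 := fun i => by rw [pow_right_comm, ht.pow_eq_one, one_pow]
    simpa [hA, hB, mul_pow, hζ] using hval
  refine ⟨b * n, a * n, n, by omega, ?_⟩
  rw [hA, hB, mul_pow, mul_pow, ← C_pow, ← C_pow, hcd]
  ring

theorem exists_unitary_pow_mul_eq_of_dvd_expand {F : Type*} [Field F] [IsAlgClosed F]
    {S : Finset F} {A B G H : F[X]} (h : UnitaryOutside S A B) {m : ℕ} (hm : (m : F) ≠ 0)
    (hG : G ≠ 0) (hH : H ≠ 0) (hGm : G.natDegree < m) (hHm : H.natDegree < m)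
    (hAG : A ^ m ∣ expand F m G) (hBH : B ^ m ∣ expand F m H) :
    ∃ a b r : ℕ, 1 ≤ r ∧ A ^ r * X ^ a = B ^ r * X ^ b := by
  refine h.exists_pow_mul_eq fun α hα => ⟨fun hA => hGm.not_ge ?_, fun hB => hHm.not_ge ?_⟩
  · exact le_natDegree_of_X_sub_C_pow_dvd_expand hm hG hα
      ((pow_dvd_pow_of_dvd (dvd_iff_isRoot.mpr hA) m).trans hAG)
  · exact le_natDegree_of_X_sub_C_pow_dvd_expand hm hH hα
      ((pow_dvd_pow_of_dvd (dvd_iff_isRoot.mpr hB) m).trans hBH)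

theorem Polynomial.map_eval_of_coeff_fixed {R : Type*} [CommSemiring R] (f : R →+* R) {A : R[X]}
    (h : ∀ i, f (A.coeff i) = A.coeff i) (x : R) : f (A.eval x) = A.eval (f x) := by
  have hA : A.map f = A := ext fun i => by rw [coeff_map, h]
  rw [← eval_map_apply, hA]

theorem exists_finiteDimensional_coeff_mem {k F : Type*} [Field k] [Field F] [Algebra k F]
    [Algebra.IsAlgebraic k F] (A B : F[X]) :
    ∃ E : IntermediateField k F, FiniteDimensional k E ∧
      ∀ i, A.coeff i ∈ E ∧ B.coeff i ∈ E := by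
  have hfin : (Set.range A.coeff ∪ Set.range B.coeff).Finite :=
    (A.finite_range_coeff).union (B.finite_range_coeff)
  have := hfin.to_subtype
  refine ⟨IntermediateField.adjoin k (Set.range A.coeff ∪ Set.range B.coeff),
    IntermediateField.finiteDimensional_adjoin fun x _ => Algebra.IsIntegral.isIntegral x,
    fun i => ⟨?_, ?_⟩⟩
  · exact IntermediateField.subset_adjoin _ _ (Or.inl ⟨i, rfl⟩)
  · exact IntermediateField.subset_adjoin _ _ (Or.inr ⟨i, rfl⟩)

theorem exists_algEquiv_pow_fixes {k F : Type*} [Field k] [Field F] [Algebra k F]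
    [Normal k F] (E : IntermediateField k F) [FiniteDimensional k E] :
    ∃ g : ℕ, 0 < g ∧ ∀ σ : Gal(F/k), ∀ x ∈ E, (σ ^ g) x = x := by
  let N := IntermediateField.normalClosure k E F
  refine ⟨Nat.card Gal(N/k), Nat.card_pos, fun σ x hx => ?_⟩
  have hxN : x ∈ N := E.le_normalClosure hx
  have := AlgEquiv.restrictNormal_commutes (σ ^ Nat.card Gal(N/k)) N ⟨x, hxN⟩
  change _ = (σ ^ Nat.card Gal(N/k)) x at this
  rw [← this]
  change algebraMap N F (AlgEquiv.restrictNormalHom N (σ ^ Nat.card Gal(N/k)) _) = x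
  rw [map_pow, pow_card_eq_one']
  rfl

theorem IsPrimitiveRoot.exists_algEquiv_apply_eq_pow {F : Type*} [Field F] [hF : Algebra ℚ F]
    [Normal ℚ F] {ζ : F} {n j : ℕ} (hζ : IsPrimitiveRoot ζ n) (hn : 0 < n)
    (hj : j.Coprime n) : ∃ σ : Gal(F/ℚ), σ ζ = ζ ^ j := by
  have := algebraRat.charZero F
  refine isConjRoot_iff_exists_algEquiv.mp ?_
  obtain rfl : hF = DivisionRing.toRatAlgebra := Subsingleton.elim _ _
  exact (cyclotomic_eq_minpoly_rat (hζ.pow_of_coprime j hj) hn).symm.trans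
    (cyclotomic_eq_minpoly_rat hζ hn)

theorem AlgEquiv.pow_apply_eq_pow_pow {k F : Type*} [Field k] [Field F] [Algebra k F]
    {σ : Gal(F/k)} {ζ : F} {j : ℕ} (h : σ ζ = ζ ^ j) (g : ℕ) : (σ ^ g) ζ = ζ ^ j ^ g := by
  induction g with
  | zero => simp
  | succ g ih => rw [pow_succ', AlgEquiv.mul_apply, ih, map_pow, h, ← pow_mul, ← pow_succ']

theorem exists_unitary_pow_mul_eq_of_rat {F : Type*} [Field F] [hF : Algebra ℚ F] [IsAlgClosed F]
    [Algebra.IsAlgebraic ℚ F] {S : Finset F} {A B : F[X]} (hA : A ≠ 0) (hB : B ≠ 0)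
    (hAB : IsCoprime A B) (h : UnitaryOutside S A B) :
    ∃ a b r : ℕ, 1 ≤ r ∧ A ^ r * X ^ a = B ^ r * X ^ b := by
  have := algebraRat.charZero F
  have : IsAlgClosure ℚ F := ⟨inferInstance, inferInstance⟩
  have : Normal ℚ F := IsAlgClosure.normal ℚ F
  obtain ⟨E, _, hE⟩ := exists_finiteDimensional_coeff_mem (k := ℚ) A B
  obtain ⟨g, hg, hfix⟩ := exists_algEquiv_pow_fixes E
  set s := A.natDegree + B.natDegree
  set j := (2 ^ g) ^ s
  have hsj : s < j := Nat.lt_pow_self (Nat.one_lt_two_pow hg.ne')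
  have hinf : {ζ : F | ∃ t, IsPrimitiveRoot ζ (2 * t + 1)}.Infinite :=
    infinite_setOf_isPrimitiveRoot two_pos fun t => Nat.cast_ne_zero.mpr (by omega)
  have hid : expand F j A * B ^ j = expand F j B * A ^ j := by
    classical
    refine eq_of_infinite_eval_eq _ _ ((hinf.sdiff
      (S ∪ B.roots.toFinset).finite_toSet).mono ?_)
    rintro ζ ⟨⟨t, ht⟩, hζ⟩
    simp only [Finset.coe_union, Set.mem_union, Finset.mem_coe, Multiset.mem_toFinset,
      mem_roots hB, not_or] at hζ
    obtain ⟨σ, hσ⟩ := ht.exists_algEquiv_apply_eq_pow (Nat.succ_pos _) (j := 2) (by simp)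
    set τ : Gal(F/ℚ) := (σ ^ g) ^ s
    have hτfix : ∀ x ∈ E, τ x = x := fun x hx => by
      rw [show τ = (σ ^ s) ^ g by rw [← pow_mul, mul_comm, pow_mul]]
      exact hfix _ x hx
    have hτζ : τ ζ = ζ ^ j := AlgEquiv.pow_apply_eq_pow_pow (AlgEquiv.pow_apply_eq_pow_pow hσ g) s
    have hτA : τ (A.eval ζ) = A.eval (ζ ^ j) := hτζ ▸
      map_eval_of_coeff_fixed (τ : F →+* F) (fun i => hτfix _ (hE i).1) ζ
    have hτB : τ (B.eval ζ) = B.eval (ζ ^ j) := hτζ ▸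
      map_eval_of_coeff_fixed (τ : F →+* F) (fun i => hτfix _ (hE i).2) ζ
    obtain ⟨m, -, hm⟩ := ht.eq_pow_of_pow_eq_one (ξ := A.eval ζ / B.eval ζ) (by
      rw [div_pow, h ζ _ (Nat.succ_pos _) ht hζ.1, div_self (pow_ne_zero _ hζ.2)])
    rw [eq_div_iff hζ.2] at hm
    simp only [Set.mem_ofPred_eq, eval_mul, expand_eval, eval_pow]
    rw [← hτA, ← hτB, ← hm, map_mul, map_pow, hτζ]
    ring
  have hj0 : (j : F) ≠ 0 := Nat.cast_ne_zero.mpr (by omega)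
  refine exists_unitary_pow_mul_eq_of_dvd_expand h hj0 hA hB (by omega) (by omega) ?_ ?_
  · exact (hAB.pow (m := j) (n := j)).dvd_of_dvd_mul_right (hid ▸ dvd_mul_left _ _)
  · exact (hAB.pow (m := j) (n := j)).symm.dvd_of_dvd_mul_right (hid ▸ dvd_mul_left _ _)

theorem Polynomial.eval_pow_mul_eval_reflect {F : Type*} [Field F] {A : F[X]} {N Q : ℕ}
    (hN : A.natDegree ≤ N) {ζ : F} (hζ : ζ ^ (Q ^ 2 + Q + 1) = 1)
    (hfrob : ∀ x, A.eval x ^ Q = A.eval (x ^ Q)) :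
    A.eval ζ ^ (Q + 1) * (A.reflect N).eval (ζ ^ (Q + 1)) =
      A.eval ζ ^ (Q ^ 2 + Q + 1) * (ζ ^ (Q + 1)) ^ N := by
  have hinv : ζ ^ Q ^ 2 * ζ ^ (Q + 1) = 1 := by rw [← pow_add, ← hζ, add_assoc]
  let : Invertible (ζ ^ Q ^ 2) := ⟨ζ ^ (Q + 1), by rw [mul_comm, hinv], hinv⟩
  have h := eval₂_reflect_mul_pow (RingHom.id F) (ζ ^ Q ^ 2) N A hN
  change eval (ζ ^ (Q + 1)) (A.reflect N) * (ζ ^ Q ^ 2) ^ N = eval (ζ ^ Q ^ 2) A at h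
  have h2 : eval (ζ ^ Q ^ 2) A = A.eval ζ ^ Q ^ 2 := by
    rw [sq, pow_mul, ← hfrob, ← hfrob, pow_mul]
  rw [add_assoc, pow_add _ (Q ^ 2), ← h2, ← h]
  have : (ζ ^ Q ^ 2) ^ N * (ζ ^ (Q + 1)) ^ N = 1 := by rw [← mul_pow, hinv, one_pow]
  linear_combination (- (eval ζ A ^ (Q + 1) * eval (ζ ^ (Q + 1)) (A.reflect N))) * this

theorem exists_unitary_pow_mul_eq_of_zmod {p : ℕ} [Fact p.Prime] {F : Type*} [Field F]
    [Algebra (ZMod p) F] [IsAlgClosed F] [Algebra.IsAlgebraic (ZMod p) F] {S : Finset F}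
    {A B : F[X]} (hA : A ≠ 0) (hB : B ≠ 0)
    (hAB : IsCoprime A B) (h : UnitaryOutside S A B) :
    ∃ a b r : ℕ, 1 ≤ r ∧ A ^ r * X ^ a = B ^ r * X ^ b := by
  have : CharP F p := charP_of_injective_algebraMap' (ZMod p) p
  obtain ⟨E, _, hE⟩ := exists_finiteDimensional_coeff_mem (k := ZMod p) A B
  have : Finite E := Module.finite_of_finite (ZMod p)
  let := Fintype.ofFinite E
  have : CharP E p := charP_of_injective_algebraMap' (ZMod p) p
  obtain ⟨e, -, hcard⟩ := FiniteField.card E p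
  set N := A.natDegree + B.natDegree
  set s := 2 * N + S.card + 1
  set Q := Fintype.card E ^ s
  have hQp : Q = p ^ ((e : ℕ) * s) := by rw [pow_mul, ← hcard]
  have hsQ : s < Q := Nat.lt_pow_self Fintype.one_lt_card
  have hfixE : ∀ x ∈ E, x ^ Q = x := fun x hx =>
    congrArg Subtype.val (FiniteField.pow_card_pow s (⟨x, hx⟩ : E))
  have hfrob : ∀ D : F[X], (∀ i, D.coeff i ∈ E) → ∀ x, D.eval x ^ Q = D.eval (x ^ Q) := by
    intro D hD x
    have hQ : ∀ y : F, iterateFrobenius F p ((e : ℕ) * s) y = y ^ Q := fun y => by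
      rw [iterateFrobenius_def, hQp]
    rw [← hQ, ← hQ]
    exact map_eval_of_coeff_fixed _ (fun i => by rw [hQ, hfixE _ (hD i)]) x
  have hQ0 : (Q : F) = 0 := by
    rw [hQp, Nat.cast_pow, CharP.cast_eq_zero, zero_pow]
    have := e.pos
    positivity
  clear_value Q
  have hn : ((Q ^ 2 + Q + 1 : ℕ) : F) ≠ 0 := by simp [hQ0]
  have : NeZero ((Q ^ 2 + Q + 1 : ℕ) : F) := ⟨hn⟩
  have hdegA : (A.reflect N).natDegree ≤ N := natDegree_reflect_le.trans (by omega)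
  have hdegB : (B.reflect N).natDegree ≤ N := natDegree_reflect_le.trans (by omega)
  have hid : A ^ (Q + 1) * expand F (Q + 1) (A.reflect N) =
      B ^ (Q + 1) * expand F (Q + 1) (B.reflect N) := by
    classical
    obtain ⟨ξ, hξ⟩ := HasEnoughRootsOfUnity.exists_primitiveRoot F (Q ^ 2 + Q + 1)
    rw [← sub_eq_zero]
    refine eq_zero_of_natDegree_lt_card_of_eval_eq_zero' _
      (nthRootsFinset (Q ^ 2 + Q + 1) 1 \ S) (fun ζ hζ => ?_) ?_
    · rw [Finset.mem_sdiff, mem_nthRootsFinset (by omega)] at hζ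
      have hval : A.eval ζ ^ (Q ^ 2 + Q + 1) = B.eval ζ ^ (Q ^ 2 + Q + 1) := by
        obtain ⟨c, hc⟩ := orderOf_dvd_of_pow_eq_one hζ.1
        rw [hc, pow_mul, pow_mul, h ζ _ (orderOf_pos_iff.mpr
          (isOfFinOrder_iff_pow_eq_one.mpr ⟨_, Nat.succ_pos _, hζ.1⟩))
          (IsPrimitiveRoot.orderOf ζ) hζ.2]
      simp only [eval_sub, eval_mul, eval_pow, expand_eval]
      rw [eval_pow_mul_eval_reflect (by omega) hζ.1 (hfrob A fun i => (hE i).1),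
        eval_pow_mul_eval_reflect (by omega) hζ.1 (hfrob B fun i => (hE i).2), hval, sub_self]
    · have hcardle := Finset.le_card_sdiff S (nthRootsFinset (Q ^ 2 + Q + 1) (1 : F))
      rw [hξ.card_nthRootsFinset] at hcardle
      have hbound : ∀ D : F[X], D.natDegree ≤ N → (D.reflect N).natDegree ≤ N →
          (D ^ (Q + 1) * expand F (Q + 1) (D.reflect N)).natDegree ≤ (Q + 1) * N + N * (Q + 1) := by
        intro D hD hD'
        refine natDegree_mul_le.trans (Nat.add_le_add ?_ ?_)
        · exact natDegree_pow_le.trans (Nat.mul_le_mul_left _ hD)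
        · rw [natDegree_expand]
          exact Nat.mul_le_mul_right _ hD'
      refine (natDegree_sub_le_of_le (hbound A (by omega) hdegA)
        (hbound B (by omega) hdegB)).trans_lt ?_
      rw [max_self]
      have : S.card + (2 * N) * (Q + 1) < Q ^ 2 + Q + 1 := by
        nlinarith [Nat.mul_le_mul_right (Q + 1) hsQ.le, show s = 2 * N + S.card + 1 from rfl]
      have h2 : (Q + 1) * N + N * (Q + 1) = 2 * N * (Q + 1) := by ring
      omega
  refine exists_unitary_pow_mul_eq_of_dvd_expand h (m := Q + 1) (G := B.reflect N)
    (H := A.reflect N) (by simp [hQ0]) (reflect_eq_zero_iff.not.mpr hB) (reflect_eq_zero_iff.not.mpr hA)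
    (by omega) (by omega) ?_ ?_
  · exact (hAB.pow (m := Q + 1) (n := Q + 1)).dvd_of_dvd_mul_left (hid ▸ dvd_mul_right _ _)
  · exact (hAB.pow (m := Q + 1) (n := Q + 1)).symm.dvd_of_dvd_mul_left (hid ▸ dvd_mul_right _ _)

theorem exists_unitary_pow_mul_eq_of_forall_subfield {F K : Type*} [Field F] [Field K]
    [Algebra F K] [IsAlgClosed F] {S : Finset K} {A B : K[X]} (hA : A ≠ 0) (hB : B ≠ 0)
    (h : UnitaryOutside S A B)
    (hroots : ∀ (x : K) (n : ℕ), 0 < n → x ^ n = 1 → x ∈ (algebraMap F K).range)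
    (hF : ∀ (T : Finset F) (C D : F[X]), C ≠ 0 → D ≠ 0 → IsCoprime C D → UnitaryOutside T C D →
      ∃ a b r : ℕ, 1 ≤ r ∧ C ^ r * X ^ a = D ^ r * X ^ b) :
    ∃ a b r : ℕ, 1 ≤ r ∧ A ^ r * X ^ a = B ^ r * X ^ b := by
  classical
  have hinj := (algebraMap F K).injective
  set T : Finset F := (S ∪ B.roots.toFinset).preimage (algebraMap F K) hinj.injOn
  have hT : ∀ ζ : F, ζ ∉ T → algebraMap F K ζ ∉ S ∧ B.eval (algebraMap F K ζ) ≠ 0 := by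
    intro ζ hζ
    simpa only [T, Finset.mem_preimage, Finset.mem_union, Multiset.mem_toFinset, mem_roots hB,
      not_or, IsRoot, ne_eq] using hζ
  obtain ⟨d, hd, hne⟩ := exists_forall_natCast_mul_add_one_ne_zero F
  obtain ⟨A₀, B₀, hB₀, hAB₀⟩ := exists_mul_map_eq_mul_map_of_infinite (F := F) (A := A) hB <| by
    refine ((infinite_setOf_isPrimitiveRoot hd hne).sdiff T.finite_toSet).mono ?_
    rintro ζ ⟨⟨t, ht⟩, hζ⟩
    obtain ⟨hζS, hζB⟩ := hT ζ hζ
    have hval := h _ _ (Nat.succ_pos _) (ht.map_of_injective hinj) hζS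
    obtain ⟨c, hc⟩ := hroots (A.eval (algebraMap F K ζ) / B.eval (algebraMap F K ζ)) _
      (Nat.succ_pos (d * t)) (by rw [div_pow, hval, div_self (pow_ne_zero _ hζB)])
    exact ⟨c, by rw [hc, div_mul_cancel₀ _ hζB]⟩
  obtain ⟨A₁, B₁, hA₁, hB₁, hunit⟩ := extract_gcd A₀ B₀
  have hcop : IsCoprime A₁ B₁ := (gcd_isUnit_iff _ _).mp hunit
  have hg : gcd A₀ B₀ ≠ 0 := fun h0 => hB₀ (by rw [hB₁, h0, zero_mul])
  have hB₁0 : B₁ ≠ 0 := fun h0 => hB₀ (by rw [hB₁, h0, mul_zero])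
  generalize gcd A₀ B₀ = g at hA₁ hB₁ hg
  have hAB : A * B₁.map (algebraMap F K) = B * A₁.map (algebraMap F K) := by
    have hg' := (Polynomial.map_ne_zero_iff hinj).mpr hg
    refine mul_left_cancel₀ hg' ?_
    rw [hA₁, hB₁, Polynomial.map_mul, Polynomial.map_mul] at hAB₀
    linear_combination hAB₀
  have hA₁0 : A₁ ≠ 0 := by
    rintro rfl
    simp [hA, hB₁0] at hAB
  obtain ⟨a, b, r, hr, hE⟩ := hF T A₁ B₁ hA₁0 hB₁0 hcop fun ζ n hn hζ hζT => by
    obtain ⟨hζS, hζB⟩ := hT ζ hζT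
    have hval := h _ _ hn (hζ.map_of_injective hinj) hζS
    have hev := congrArg (fun R : K[X] => (R.eval (algebraMap F K ζ)) ^ n) hAB
    simp only [eval_mul, eval_map_apply, mul_pow, hval] at hev
    apply hinj
    rw [map_pow, map_pow, mul_left_cancel₀ (pow_ne_zero n hζB) hev]
  refine ⟨a, b, r, hr, ?_⟩
  have hE' := congrArg (Polynomial.map (algebraMap F K)) hE
  simp only [Polynomial.map_mul, Polynomial.map_pow, map_X] at hE'
  have hA₁' := pow_ne_zero r ((Polynomial.map_ne_zero_iff hinj).mpr hA₁0)
  have hABr := congrArg (· ^ r) hAB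
  simp only [mul_pow] at hABr
  refine mul_left_cancel₀ hA₁' ?_
  linear_combination A ^ r * hE' + X ^ b * hABr

theorem exists_unitary_pow_mul_eq {K : Type*} [Field K] [IsAlgClosed K] {S : Finset K}
    {A B : K[X]} (hA : A ≠ 0) (hB : B ≠ 0) (h : UnitaryOutside S A B) :
    ∃ a b r : ℕ, 1 ≤ r ∧ A ^ r * X ^ a = B ^ r * X ^ b := by
  have hroots : ∀ (k : Type) [Field k] [Algebra k K] (x : K) (n : ℕ), 0 < n → x ^ n = 1 →
      x ∈ (algebraMap (algebraicClosure k K) K).range := by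
    intro k _ _ x n hn hx
    have hint : IsIntegral k x := .of_pow hn (hx ▸ isIntegral_one)
    exact ⟨⟨x, mem_algebraicClosure_iff.mpr hint.isAlgebraic⟩, rfl⟩
  obtain ⟨p, hp⟩ := CharP.exists K
  rcases CharP.char_is_prime_or_zero K p with hprime | rfl
  · have : Fact p.Prime := ⟨hprime⟩
    let := ZMod.algebra K p
    have := (algebraicClosure.isAlgClosure (ZMod p) K).isAlgClosed
    exact exists_unitary_pow_mul_eq_of_forall_subfield hA hB h (hroots (ZMod p))
      fun T C D hC hD hCD hT => exists_unitary_pow_mul_eq_of_zmod (p := p) hC hD hCD hT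
  · have := CharP.charP_to_charZero K
    have := (algebraicClosure.isAlgClosure ℚ K).isAlgClosed
    exact exists_unitary_pow_mul_eq_of_forall_subfield hA hB h (hroots ℚ)
      fun T C D hC hD hCD hT => exists_unitary_pow_mul_eq_of_rat
        (hF := (algebraicClosure ℚ K).algebra') hC hD hCD hT



/-- Let `k` be a field and `P ∈ k(q)*` a nonzero rational function. If for all but
finitely many roots of unity `ζ` in the algebraic closure of `k` at which `P` is defined
one has `P(ζ)^{ord ζ} = 1` (where `ord ζ` is the order of `ζ` as a root of unity), then
there exist integers `a` and `r ≥ 1` with `P(q)^r = q^a`. -/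
theorem rational_function_with_unitary_values_at_roots_of_unity_is_power_of_q
    {k : Type*} [Field k] (P : RatFunc k) (hP : P ≠ 0)
    (h : ∃ S : Finset (AlgebraicClosure k),
      ∀ ζ : (AlgebraicClosure k)ˣ, (∃ n : ℕ, 0 < n ∧ ζ ^ n = 1) →
        (↑ζ : AlgebraicClosure k) ∉ S →
        Polynomial.aeval (↑ζ : AlgebraicClosure k) P.denom ≠ 0 →
        (RatFunc.eval (algebraMap k (AlgebraicClosure k)) (↑ζ : AlgebraicClosure k) P)
          ^ orderOf ζ = 1) :
    ∃ (a : ℤ) (r : ℕ), 1 ≤ r ∧ P ^ r = RatFunc.X ^ a := by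
  have hinj := (algebraMap k (AlgebraicClosure k)).injective
  have hnum : P.num ≠ 0 := RatFunc.num_ne_zero hP
  have hden : P.denom ≠ 0 := P.denom_ne_zero
  have hden' := (Polynomial.map_ne_zero_iff hinj).mpr hden
  obtain ⟨S, hS⟩ := h
  classical
  have hunitary : UnitaryOutside
      (S ∪ (P.denom.map (algebraMap k (AlgebraicClosure k))).roots.toFinset)
      (P.num.map (algebraMap k (AlgebraicClosure k)))
      (P.denom.map (algebraMap k (AlgebraicClosure k))) := by
    intro ζ n hn hζ hζS
    rw [Finset.mem_union, Multiset.mem_toFinset, mem_roots hden', not_or, IsRoot, eval_map] at hζS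
    have hu := hζ.isUnit hn.ne'
    have hprim : IsPrimitiveRoot hu.unit n := IsPrimitiveRoot.coe_units_iff.mp hζ
    have hval := hS hu.unit ⟨n, hn, hprim.pow_eq_one⟩ hζS.1 hζS.2
    rw [← hprim.eq_orderOf, RatFunc.eval, div_pow, IsUnit.unit_spec,
      div_eq_one_iff_eq (pow_ne_zero _ hζS.2)] at hval
    rwa [eval_map, eval_map]
  obtain ⟨a, b, r, hr, hE⟩ := exists_unitary_pow_mul_eq
    ((Polynomial.map_ne_zero_iff hinj).mpr hnum) hden' hunitary
  have hE' : P.num ^ r * X ^ a = P.denom ^ r * X ^ b := by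
    apply map_injective _ hinj
    simpa using hE
  refine ⟨(b : ℤ) - a, r, hr, ?_⟩
  have hR := congrArg (algebraMap k[X] (RatFunc k)) hE'
  simp only [map_mul, map_pow, RatFunc.algebraMap_X] at hR
  rw [zpow_sub₀ RatFunc.X_ne_zero, zpow_natCast, zpow_natCast,
    eq_div_iff (pow_ne_zero _ RatFunc.X_ne_zero)]
  conv_lhs => rw [← RatFunc.num_div_denom P]
  rw [div_pow, div_mul_eq_mul_div, hR,
    mul_div_cancel_left₀ _ (pow_ne_zero _ (RatFunc.algebraMap_ne_zero hden))]
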